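/- arXiv:1011.1264 — 3 statements merged into one kernel-verified Lean document; each statement's English description precedes it below -/
import Mathlib

section
/- Fix n ≥ 1 and m with 1 ≤ m ≤ 2^{2n}, and let V be drawn uniformly at random from the set of injective functions from Fin m into BitVec n × BitVec n (i.e., m uniformly distributed but distinct 2n-bit values). Then the probability that there exist indices i ≠ j such that (V i).1 = (V j).1 or (V i).2 = (V j).2 (a collision among the first halves or among the second halves) is at most m² · (2^n − 1)/(2^{2n} − 1). -/
open scoped ENNReal

instance (n : ℕ) : Fintype (BitVec n) :=
  Fintype.ofEquiv (Fin (2 ^ n)) ⟨BitVec.ofFin, BitVec.toFin, fun _ => rfl, fun _ => rfl⟩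

/-- Any ordered pair of distinct points is mapped to any other one by some permutation. -/
lemma exists_perm_apply_eq_of_ne {β : Type*} [DecidableEq β] {a b a' b' : β}
    (h : a ≠ b) (h' : a' ≠ b') : ∃ σ : Equiv.Perm β, σ a = a' ∧ σ b = b' := by
  refine ⟨(Equiv.swap a a').trans (Equiv.swap (Equiv.swap a a' b) b'), ?_, ?_⟩
  · have hne : a' ≠ Equiv.swap a a' b := fun hab =>
      h ((Equiv.swap a a').injective (by rwa [Equiv.swap_apply_left]))
    rw [Equiv.trans_apply, Equiv.swap_apply_left, Equiv.swap_apply_of_ne_of_ne hne h']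
  · rw [Equiv.trans_apply, Equiv.swap_apply_left]

section InjectiveTuples

variable {ι β : Type*} [Fintype ι] [DecidableEq ι] [Fintype β] [DecidableEq β]

lemma card_injective_fiber_eq (i j : ι) {p q : β × β} (hp : p.1 ≠ p.2) (hq : q.1 ≠ q.2) :
    (Finset.univ.filter fun V : ι → β => Function.Injective V ∧ (V i, V j) = p).card =
      (Finset.univ.filter fun V : ι → β => Function.Injective V ∧ (V i, V j) = q).card := by
  obtain ⟨σ, h1, h2⟩ := exists_perm_apply_eq_of_ne hp hq
  refine Finset.card_equiv (Equiv.arrowCongr (Equiv.refl ι) σ) fun V => ?_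
  have hV : Equiv.arrowCongr (Equiv.refl ι) σ V = σ ∘ V := rfl
  simp only [Finset.mem_filter, Finset.mem_univ, true_and, Prod.ext_iff, hV,
    Function.comp_apply, EquivLike.comp_injective, ← h1, ← h2, EmbeddingLike.apply_eq_iff_eq]

/-- Two coordinates of a uniform injective tuple form a uniform pair of distinct elements. -/
lemma card_injective_filter_mul_card_offDiag {i j : ι} (hij : i ≠ j) (R : β → β → Prop)
    [DecidableRel R] :
    (Finset.univ.filter fun V : ι → β => Function.Injective V ∧ R (V i) (V j)).card *
        (Finset.univ : Finset β).offDiag.card =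
      ((Finset.univ : Finset β).offDiag.filter fun p => R p.1 p.2).card *
        (Finset.univ.filter fun V : ι → β => Function.Injective V).card := by
  obtain ⟨c, hc⟩ : ∃ c, ∀ p ∈ (Finset.univ : Finset β).offDiag,
      (Finset.univ.filter fun V : ι → β => Function.Injective V ∧ (V i, V j) = p).card = c := by
    rcases (Finset.univ : Finset β).offDiag.eq_empty_or_nonempty with h | ⟨q, hq⟩
    · exact ⟨0, by simp [h]⟩
    · exact ⟨_, fun p hp => card_injective_fiber_eq i j (Finset.mem_offDiag.1 hp).2.2
        (Finset.mem_offDiag.1 hq).2.2⟩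
  have key (R : β → β → Prop) [DecidableRel R] :
      (Finset.univ.filter fun V : ι → β => Function.Injective V ∧ R (V i) (V j)).card =
      ((Finset.univ : Finset β).offDiag.filter fun p => R p.1 p.2).card * c := by
    rw [Finset.card_eq_sum_card_fiberwise (f := fun V : ι → β => (V i, V j))
      (t := (Finset.univ : Finset β).offDiag.filter fun p => R p.1 p.2), ← smul_eq_mul]
    · refine Finset.sum_eq_card_nsmul fun p hp => ?_
      rw [Finset.mem_filter] at hp
      rw [← hc p hp.1, Finset.filter_filter]
      congr 1
      ext V
      simp only [Finset.mem_filter, Finset.mem_univ, true_and]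
      constructor
      · rintro ⟨⟨hV, -⟩, h⟩
        exact ⟨hV, h⟩
      · rintro ⟨hV, rfl⟩
        exact ⟨⟨hV, hp.2⟩, rfl⟩
    · intro V hV
      simp only [Finset.coe_filter, Finset.mem_univ, true_and, Set.mem_ofPred_eq] at hV
      simpa using ⟨hV.1.ne hij, hV.2⟩
  have hS : (Finset.univ.filter fun V : ι → β => Function.Injective V).card =
      (Finset.univ : Finset β).offDiag.card * c := by
    simpa using key fun _ _ => True
  rw [key R, hS]
  ring

end InjectiveTuples

section HalfCollision

variable {α γ : Type*} [Fintype α] [Fintype γ]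

lemma card_offDiag_filter_fst_eq [DecidableEq α] :
    ((Finset.univ : Finset (α × γ)).offDiag.filter fun p => p.1.1 = p.2.1).card =
      Fintype.card α * (Finset.univ : Finset γ).offDiag.card := by
  rw [← Finset.card_univ, ← Finset.card_product]
  refine Finset.card_bij' (fun p _ => (p.1.1, (p.1.2, p.2.2)))
    (fun q _ => ((q.1, q.2.1), (q.1, q.2.2))) ?_ ?_ ?_ ?_
  · rintro ⟨⟨a, b⟩, ⟨c, d⟩⟩ h
    simp_all
  · rintro ⟨a, b, c⟩ h
    simp_all
  · rintro ⟨⟨a, b⟩, ⟨c, d⟩⟩ h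
    simp_all
  · rintro ⟨a, b, c⟩ h
    rfl

lemma card_offDiag_filter_snd_eq [DecidableEq γ] :
    ((Finset.univ : Finset (α × γ)).offDiag.filter fun p => p.1.2 = p.2.2).card =
      Fintype.card γ * (Finset.univ : Finset α).offDiag.card := by
  rw [← card_offDiag_filter_fst_eq]
  exact Finset.card_equiv ((Equiv.prodComm α γ).prodCongr (Equiv.prodComm α γ)) fun p => by
    simp [Prod.ext_iff, and_comm]

/-- Two coordinates of a uniform injective tuple of pairs agree in a fixed half with probability
`(|α| - 1) / (|α| ^ 2 - 1)`; the proposition `P` selects the half. -/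
lemma card_injective_half_eq_mul [DecidableEq α] [Nonempty α] {ι : Type*} [Fintype ι] [DecidableEq ι] {i j : ι}
    (hij : i ≠ j) (P : Prop) [Decidable P] :
    (Finset.univ.filter fun V : ι → α × α => Function.Injective V ∧
        if P then (V i).1 = (V j).1 else (V i).2 = (V j).2).card * (Fintype.card α ^ 2 - 1) =
      (Fintype.card α - 1) *
        (Finset.univ.filter fun V : ι → α × α => Function.Injective V).card := by
  have h := card_injective_filter_mul_card_offDiag hij
    (fun x y : α × α => if P then x.1 = y.1 else x.2 = y.2)
  have hR : ((Finset.univ : Finset (α × α)).offDiag.filter fun p =>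
      if P then p.1.1 = p.2.1 else p.1.2 = p.2.2).card =
      Fintype.card α ^ 2 * (Fintype.card α - 1) := by
    have hd : Fintype.card α * (Finset.univ : Finset α).offDiag.card =
        Fintype.card α ^ 2 * (Fintype.card α - 1) := by
      rw [Finset.offDiag_card, Finset.card_univ, ← Nat.mul_sub_one]
      ring
    by_cases hP : P
    · simp only [hP, if_true, card_offDiag_filter_fst_eq, hd]
    · simp only [hP, if_false, card_offDiag_filter_snd_eq, hd]
  have hD : (Finset.univ : Finset (α × α)).offDiag.card =
      Fintype.card α ^ 2 * (Fintype.card α ^ 2 - 1) := by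
    rw [Finset.offDiag_card, Finset.card_univ, Fintype.card_prod, ← Nat.mul_sub_one, ← sq]
  rw [hR, hD] at h
  refine Nat.eq_of_mul_eq_mul_left (pow_pos (Fintype.card_pos (α := α)) 2) ?_
  linarith

lemma card_injective_half_collision_mul_le [DecidableEq α] [Nonempty α] {ι : Type*}
    [Fintype ι] [LinearOrder ι] :
    (Finset.univ.filter fun V : ι → α × α => Function.Injective V ∧
        ∃ i j, i ≠ j ∧ ((V i).1 = (V j).1 ∨ (V i).2 = (V j).2)).card *
          (Fintype.card α ^ 2 - 1) ≤
      Fintype.card ι ^ 2 * (Fintype.card α - 1) *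
        (Finset.univ.filter fun V : ι → α × α => Function.Injective V).card := by
  -- Ordered pairs with `i < j` account for first halves, those with `j < i` for second halves.
  have hsub : (Finset.univ.filter fun V : ι → α × α => Function.Injective V ∧
      ∃ i j, i ≠ j ∧ ((V i).1 = (V j).1 ∨ (V i).2 = (V j).2)) ⊆
      (Finset.univ : Finset ι).offDiag.biUnion fun p =>
        Finset.univ.filter fun V : ι → α × α => Function.Injective V ∧
          if p.1 < p.2 then (V p.1).1 = (V p.2).1 else (V p.1).2 = (V p.2).2 := by
    intro V hV
    simp only [Finset.mem_filter, Finset.mem_univ, true_and] at hV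
    obtain ⟨hinj, i, j, hij, h⟩ := hV
    simp only [Finset.mem_biUnion, Finset.mem_offDiag, Finset.mem_filter, Finset.mem_univ,
      true_and, Prod.exists]
    rcases hij.lt_or_gt with hlt | hlt <;> rcases h with h | h
    · exact ⟨i, j, hij, hinj, by rwa [if_pos hlt]⟩
    · exact ⟨j, i, hij.symm, hinj, by rw [if_neg hlt.not_gt, h]⟩
    · exact ⟨j, i, hij.symm, hinj, by rw [if_pos hlt, h]⟩
    · exact ⟨i, j, hij, hinj, by rwa [if_neg hlt.not_gt]⟩
  refine (Nat.mul_le_mul_right _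
    ((Finset.card_le_card hsub).trans Finset.card_biUnion_le)).trans ?_
  rw [Finset.sum_mul, Finset.sum_congr rfl fun p hp =>
    card_injective_half_eq_mul (Finset.mem_offDiag.1 hp).2.2 (p.1 < p.2), Finset.sum_const,
    smul_eq_mul, ← mul_assoc, Finset.offDiag_card, Finset.card_univ]
  gcongr
  rw [sq]
  exact Nat.sub_le _ _

end HalfCollision

/-- if `V` is drawn uniformly from the injective functions `Fin m → BitVec n × BitVec n`
(`m` uniformly distributed but distinct `2n`-bit values), the probability of a collision among the
first halves or among the second halves is at most `m² · (2^n − 1)/(2^{2n} − 1)`. -/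
theorem half_collision_probability_injective_tuple (n m : ℕ) (hn : 1 ≤ n) (hm1 : 1 ≤ m)
    (hm2 : m ≤ 2 ^ (2 * n)) :
    let S : Finset (Fin m → BitVec n × BitVec n) :=
      Finset.univ.filter (fun V => Function.Injective V)
    ∀ hS : S.Nonempty,
      (PMF.uniformOfFinset S hS).toOuterMeasure
          {V : Fin m → BitVec n × BitVec n |
            ∃ i j : Fin m, i ≠ j ∧ ((V i).1 = (V j).1 ∨ (V i).2 = (V j).2)} ≤
        ((m ^ 2 * (2 ^ n - 1) : ℕ) : ℝ≥0∞) / ((2 ^ (2 * n) - 1 : ℕ) : ℝ≥0∞) := by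
  intro S hS
  have hcard : Fintype.card (BitVec n) = 2 ^ n :=
    (Fintype.ofEquiv_card _).trans (Fintype.card_fin _)
  have hpow : 1 < 2 ^ (2 * n) := Nat.one_lt_two_pow (by omega)
  have h := card_injective_half_collision_mul_le (α := BitVec n) (ι := Fin m)
  rw [hcard, Fintype.card_fin, ← pow_mul, mul_comm n 2] at h
  classical
  rw [PMF.toOuterMeasure_uniformOfFinset_apply]
  have hy : ((2 ^ (2 * n) - 1 : ℕ) : ℝ≥0∞) ≠ 0 := Nat.cast_ne_zero.2 (by omega)
  refine ENNReal.div_le_of_le_mul ?_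
  rw [← ENNReal.mul_div_right_comm, ENNReal.le_div_iff_mul_le (.inl hy) (.inl (by finiteness))]
  norm_cast
  convert h using 2
  simp only [S, Finset.filter_filter, Set.mem_ofPred_eq]
  congr!
end

section
/- Fix n and a table assignment (G, P↓, P↑) that is P-consistent. Then for all partial chains C and D: Next(C) = some D if and only if Prev(D) = some C. -/
/-- A table assignment: partial round-function tables `G i` (used for `i ∈ {1, …, 14}`) and
partial permutation tables `P↓` (`Pdown`) and `P↑` (`Pup`). -/
structure FeistelTables (n : ℕ) where
  G : ℕ → BitVec n → Option (BitVec n)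
  Pdown : BitVec n × BitVec n → Option (BitVec n × BitVec n)
  Pup : BitVec n × BitVec n → Option (BitVec n × BitVec n)

/-- A partial chain: a triple `(x_k, x_{k+1}, k)` with `k ∈ {0, …, 14}`. -/
abbrev PChain (n : ℕ) := BitVec n × BitVec n × Fin 15

/-- The `Next` map on partial chains. -/
def FeistelTables.Next {n : ℕ} (T : FeistelTables n) (C : PChain n) : Option (PChain n) :=
  if h : (C.2.2 : ℕ) < 14 then
    match T.G ((C.2.2 : ℕ) + 1) C.2.1 with
    | none => none
    | some g => some (C.2.1, C.1 ^^^ g, ⟨(C.2.2 : ℕ) + 1, by omega⟩)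
  else
    match T.Pup (C.1, C.2.1) with
    | none => none
    | some p => some (p.1, p.2, (0 : Fin 15))

/-- The `Prev` map on partial chains. -/
def FeistelTables.Prev {n : ℕ} (T : FeistelTables n) (C : PChain n) : Option (PChain n) :=
  if h : 0 < (C.2.2 : ℕ) then
    match T.G (C.2.2 : ℕ) C.1 with
    | none => none
    | some g => some (C.2.1 ^^^ g, C.1, ⟨(C.2.2 : ℕ) - 1, by omega⟩)
  else
    match T.Pdown (C.1, C.2.1) with
    | none => none
    | some p => some (p.1, p.2, (14 : Fin 15))

/-- `P`-consistency: `P↓(x_0,x_1) = some (x_14,x_15)` iff `P↑(x_14,x_15) = some (x_0,x_1)`. -/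
def FeistelTables.PConsistent {n : ℕ} (T : FeistelTables n) : Prop :=
  ∀ p q : BitVec n × BitVec n, T.Pdown p = some q ↔ T.Pup q = some p

theorem FeistelTables.next_eq_some_iff {n : ℕ} (T : FeistelTables n) (a b c d : BitVec n)
    (k l : Fin 15) :
    T.Next (a, b, k) = some (c, d, l) ↔
      ((k : ℕ) + 1 = l ∧ c = b ∧ T.G l b = some (a ^^^ d)) ∨
        ((k : ℕ) = 14 ∧ (l : ℕ) = 0 ∧ T.Pup (a, b) = some (c, d)) := by
  have xor_eq (g : BitVec n) : a ^^^ g = d ↔ g = a ^^^ d := by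
    constructor <;> rintro rfl <;> simp
  unfold FeistelTables.Next
  by_cases h : (k : ℕ) < 14
  · have hk : (k : ℕ) ≠ 14 := h.ne
    by_cases hl : (k : ℕ) + 1 = l
    · cases hg : T.G (l : ℕ) b <;> simp [h, hk, hl, hg, xor_eq] <;> grind
    · cases hg : T.G ((k : ℕ) + 1) b <;> simp [h, hk, hl] <;> grind
  · have hk : (k : ℕ) = 14 := by omega
    have hl : 14 + 1 ≠ (l : ℕ) := by omega
    cases hp : T.Pup (a, b) <;> simp [hk, hl, Prod.ext_iff] <;> grind

theorem FeistelTables.prev_eq_some_iff {n : ℕ} (T : FeistelTables n) (a b c d : BitVec n)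
    (k l : Fin 15) :
    T.Prev (c, d, l) = some (a, b, k) ↔
      ((k : ℕ) + 1 = l ∧ c = b ∧ T.G l b = some (a ^^^ d)) ∨
        ((k : ℕ) = 14 ∧ (l : ℕ) = 0 ∧ T.Pdown (c, d) = some (a, b)) := by
  have xor_eq (g : BitVec n) : d ^^^ g = a ↔ g = a ^^^ d := by
    rw [BitVec.xor_comm a d]
    constructor <;> rintro rfl <;> simp
  unfold FeistelTables.Prev
  by_cases h : 0 < (l : ℕ)
  · have hl : (l : ℕ) ≠ 0 := h.ne'
    have hkl : (l : ℕ) - 1 = k ↔ (k : ℕ) + 1 = l := by omega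
    by_cases hc : c = b
    · subst hc
      cases hg : T.G (l : ℕ) c <;> simp [h, hl, xor_eq, Fin.ext_iff, hkl, and_comm]
    · cases hg : T.G (l : ℕ) c <;> simp [h, hl, hc]
  · have hl : (l : ℕ) = 0 := by omega
    cases hp : T.Pdown (c, d) <;> simp [hl, Prod.ext_iff] <;> grind

/-- for `P`-consistent tables, `Next C = some D ↔ Prev D = some C`. -/
theorem next_eq_some_iff_prev_eq_some (n : ℕ) (T : FeistelTables n) (hT : T.PConsistent)
    (C D : PChain n) : T.Next C = some D ↔ T.Prev D = some C := by
  obtain ⟨a, b, k⟩ := C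
  obtain ⟨c, d, l⟩ := D
  rw [T.next_eq_some_iff, T.prev_eq_some_iff, hT (c, d) (a, b)]
end

section
/- Let α be a type and next, prev : α → Option α be partial maps satisfying next a = some b ↔ prev b = some a for all a, b. Define the step relation R a b := (next a = some b ∨ prev a = some b). If C and D satisfy Relation.ReflTransGen R C D, then there exists k : ℕ such that either iterating next k times starting from C (composing via Option.bind) yields some D, or iterating next k times starting from D yields some C. In particular, C and D are connected by a sequence C_1, …, C_r with {C_1, C_r} = {C, D} and C_i = next(C_{i−1}) (equivalently C_{i−1} = prev(C_i)) for all i. -/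
/-- Iterate a partial map `f : α → Option α` `k` times, composing via `Option.bind`. -/
def iterOpt {α : Type*} (f : α → Option α) : ℕ → α → Option α
  | 0, a => some a
  | k + 1, a => (f a).bind (iterOpt f k)

theorem iterOpt_succ_eq_bind {α : Type*} (f : α → Option α) (k : ℕ) (a : α) :
    iterOpt f (k + 1) a = (iterOpt f k a).bind f := by
  induction k generalizing a with
  | zero => simp [iterOpt]
  | succ k ih =>
    rw [iterOpt, iterOpt, Option.bind_assoc]
    exact congrArg _ (funext ih)

/-- if `next` and `prev` are mutually inverse partial maps and `C`, `D` are
related by the reflexive-transitive closure of the step relation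
`R a b := (next a = some b ∨ prev a = some b)`, then there is `k` such that iterating `next`
`k` times from `C` yields `some D`, or iterating `next` `k` times from `D` yields `some C`. -/
theorem reflTransGen_step_iff_iterate_next {α : Type*} (next prev : α → Option α)
    (h : ∀ a b, next a = some b ↔ prev b = some a) (C D : α)
    (hCD : Relation.ReflTransGen (fun x y => next x = some y ∨ prev x = some y) C D) :
    ∃ k : ℕ, iterOpt next k C = some D ∨ iterOpt next k D = some C := by
  induction hCD using Relation.ReflTransGen.head_induction_on with
  | refl => exact ⟨0, .inl rfl⟩
  | @head a b hab _ ih =>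
    obtain ⟨k, hk | hk⟩ := ih <;> rcases hab with hab | hab
    · exact ⟨k + 1, .inl (by simpa [iterOpt, hab] using hk)⟩
    · have hba := (h b a).2 hab
      cases k with
      | zero =>
        obtain rfl : b = D := Option.some.inj hk
        exact ⟨1, .inr (by simp [iterOpt, hba])⟩
      | succ k => exact ⟨k, .inl (by simpa [iterOpt, hba] using hk)⟩
    · cases k with
      | zero =>
        obtain rfl : D = b := Option.some.inj hk
        exact ⟨1, .inl (by simp [iterOpt, hab])⟩
      | succ k =>
        rw [iterOpt_succ_eq_bind, Option.bind_eq_some_iff] at hk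
        obtain ⟨x, hx, hxb⟩ := hk
        obtain rfl : x = a :=
          Option.some.inj (((h x b).1 hxb).symm.trans ((h a b).1 hab))
        exact ⟨k, .inr hx⟩
    · exact ⟨k + 1, .inr (by simp [iterOpt_succ_eq_bind, hk, (h b a).2 hab])⟩
end
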